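/- Define h_1 = K · tr_B^G(N·e) − D · tr_B^G(N · tr^P(a3^{p−2})), h_2 = K·h_1 − (3D)^{(p−1)/2} · tr_B^G(N·e), and h_i = K·h_{i−1} − (3D)^{(p−1)/2} · h_{i−2} for i ≥ 3. Then each h_i lies in F[V]^{SL2(F_p)} and, for all i ≥ 1, the lead term of h_i in the graded reverse lexicographic order with a0 < a1 < a2 < a3 is 2 a3^p a1^{p+2+(i−1)(p−1)}. -/

import Mathlib

open MvPolynomial

noncomputable section

/-- The right action of the 2×2 matrix `g` over `F_p` on `F[V] = F[a₃,a₂,a₁,a₀]`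
(with `aᵢ = X i`), given by the dual of the third symmetric power representation. -/
def act (p : ℕ) [Fact p.Prime] (F : Type) [Field F] [CharP F p]
    (g : Matrix (Fin 2) (Fin 2) (ZMod p)) :
    MvPolynomial (Fin 4) F →ₐ[F] MvPolynomial (Fin 4) F :=
  letI c : ZMod p → MvPolynomial (Fin 4) F := fun x => C (ZMod.castHom (dvd_refl p) F x)
  letI al := c (g 0 0)
  letI be := c (g 0 1)
  letI ga := c (g 1 0)
  letI de := c (g 1 1)
  aeval ![
    de ^ 3 * X 0 + 3 * de ^ 2 * ga * X 1 + 3 * de * ga ^ 2 * X 2 + ga ^ 3 * X 3,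
    de ^ 2 * be * X 0 + (de ^ 2 * al + 2 * de * be * ga) * X 1
      + (2 * de * ga * al + be * ga ^ 2) * X 2 + ga ^ 2 * al * X 3,
    de * be ^ 2 * X 0 + (2 * de * be * al + be ^ 2 * ga) * X 1
      + (de * al ^ 2 + 2 * be * ga * al) * X 2 + ga * al ^ 2 * X 3,
    be ^ 3 * X 0 + 3 * be ^ 2 * al * X 1 + 3 * be * al ^ 2 * X 2 + al ^ 3 * X 3]

/-- The transfer with respect to the Sylow `p`-subgroup `P = ⟨σ⟩`,
`tr^P(f) = ∑_{τ ∈ P} (f)τ`, where the elements of `P` are the matrices `[[1,s],[0,1]]`. -/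
def trP (p : ℕ) [Fact p.Prime] (F : Type) [Field F] [CharP F p]
    (f : MvPolynomial (Fin 4) F) : MvPolynomial (Fin 4) F :=
  ∑ s : ZMod p, act p F !![1, s; 0, 1] f

/-- The relative transfer `tr_B^G(f) = ∑_{τ ∈ Q ∪ {η}} (f)τ`, using the coset
representatives `Q ∪ {η}` of the Borel subgroup `B` in `G = SL₂(F_p)`. -/
def trBG (p : ℕ) [Fact p.Prime] (F : Type) [Field F] [CharP F p]
    (f : MvPolynomial (Fin 4) F) : MvPolynomial (Fin 4) F :=
  (∑ s : ZMod p, act p F !![1, 0; s, 1] f) + act p F !![0, 1; -1, 0] f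

/-- The full transfer `tr^G(f) = ∑_{τ ∈ SL₂(F_p)} (f)τ`. -/
def trG (p : ℕ) [Fact p.Prime] (F : Type) [Field F] [CharP F p]
    (f : MvPolynomial (Fin 4) F) : MvPolynomial (Fin 4) F :=
  ∑ g : Matrix.SpecialLinearGroup (Fin 2) (ZMod p), act p F g.1 f

/-- `N = ∏_{τ ∈ P} (a₃)τ = ∏_{s ∈ F_p} (a₃ + 3s a₂ + 3s² a₁ + s³ a₀)`. -/
def Npoly (p : ℕ) [Fact p.Prime] (F : Type) [Field F] [CharP F p] :
    MvPolynomial (Fin 4) F :=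
  ∏ s : ZMod p, act p F !![1, s; 0, 1] (X 3)

/-- The weight of the monomial `a₃^e₃ a₂^e₂ a₁^e₁ a₀^e₀`, i.e. `3e₃ + e₂ - e₁ - 3e₀`. -/
def wt (d : Fin 4 →₀ ℕ) : ℤ :=
  3 * (d 3 : ℤ) + (d 2 : ℤ) - (d 1 : ℤ) - 3 * (d 0 : ℤ)

/-- `f` is isobaric of weight `lam` modulo `p - 1`: every monomial occurring in `f`
has weight congruent to `lam` modulo `p - 1`. -/
def Isobaric (p : ℕ) {F : Type} [Field F] (f : MvPolynomial (Fin 4) F) (lam : ℤ) : Prop :=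
  ∀ d ∈ f.support, ((p : ℤ) - 1) ∣ (wt d - lam)

/-- Strict grevlex comparison on exponent vectors, for the graded reverse
lexicographic order with `a₀ < a₁ < a₂ < a₃`. -/
def grevlexLt (d e : Fin 4 →₀ ℕ) : Prop :=
  (∑ i : Fin 4, d i) < (∑ i : Fin 4, e i) ∨
    ((∑ i : Fin 4, d i) = (∑ i : Fin 4, e i) ∧
      ∃ k : Fin 4, e k < d k ∧ ∀ j : Fin 4, j < k → d j = e j)

/-- `d` is the lead monomial of `f` in the grevlex order with `a₀ < a₁ < a₂ < a₃`. -/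
def LeadMonomialIs {F : Type} [Field F] (f : MvPolynomial (Fin 4) F) (d : Fin 4 →₀ ℕ) : Prop :=
  coeff d f ≠ 0 ∧ ∀ e ∈ f.support, e ≠ d → grevlexLt e d

/-- The lead term of `f` is `c · x^d` in the grevlex order with `a₀ < a₁ < a₂ < a₃`. -/
def LeadTermIs {F : Type} [Field F] (f : MvPolynomial (Fin 4) F) (c : F) (d : Fin 4 →₀ ℕ) :
    Prop :=
  LeadMonomialIs f d ∧ coeff d f = c

/-- The discriminant `D` of the binary cubic. -/
def Dpoly (F : Type) [Field F] : MvPolynomial (Fin 4) F :=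
  3 * X 2 ^ 2 * X 1 ^ 2 - 4 * X 3 * X 1 ^ 3 - 4 * X 2 ^ 3 * X 0
    + 6 * X 3 * X 2 * X 1 * X 0 - X 3 ^ 2 * X 0 ^ 2

/-- `K = -tr^G(a₁^{p-1})`. -/
def Kpoly (p : ℕ) [Fact p.Prime] (F : Type) [Field F] [CharP F p] :
    MvPolynomial (Fin 4) F :=
  - trG p F (X 1 ^ (p - 1))

/-- Dickson's invariant `L = 3(a₂^p a₁ - a₂ a₁^p) - (a₃^p a₀ - a₃ a₀^p)`. -/
def Lpoly (p : ℕ) (F : Type) [Field F] : MvPolynomial (Fin 4) F :=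
  3 * (X 2 ^ p * X 1 - X 2 * X 1 ^ p) - (X 3 ^ p * X 0 - X 3 * X 0 ^ p)

/-- `e = 2a₁³ + a₀(a₃a₀ - 3a₂a₁)`. -/
def epoly (F : Type) [Field F] : MvPolynomial (Fin 4) F :=
  2 * X 1 ^ 3 + X 0 * (X 3 * X 0 - 3 * X 2 * X 1)

/-- `d = a₁² - a₂a₀`. -/
def dpoly (F : Type) [Field F] : MvPolynomial (Fin 4) F :=
  X 1 ^ 2 - X 2 * X 0

/-- `ξ = 3a₂² - 4a₃a₁`. -/
def xipoly (F : Type) [Field F] : MvPolynomial (Fin 4) F :=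
  3 * X 2 ^ 2 - 4 * X 3 * X 1

/-- The ring of `SL₂(F_p)`-invariants `F[V]^{SL₂(F_p)}`, as a subalgebra of `F[V]`. -/
def invariants (p : ℕ) [Fact p.Prime] (F : Type) [Field F] [CharP F p] :
    Subalgebra F (MvPolynomial (Fin 4) F) where
  carrier := {f | ∀ g : Matrix.SpecialLinearGroup (Fin 2) (ZMod p), act p F g.1 f = f}
  mul_mem' := fun hf hg g => by rw [map_mul, hf g, hg g]
  one_mem' := fun g => map_one _
  add_mem' := fun hf hg g => by rw [map_add, hf g, hg g]
  zero_mem' := fun g => map_zero _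
  algebraMap_mem' := fun c g => (act _ _ _).commutes c

/-- The sequence of tête-à-têtes: `hseq 0 = tr_B^G(N·e)` (auxiliary),
`hseq 1 = h₁ = K·tr_B^G(N·e) - D·tr_B^G(N·tr^P(a₃^{p-2}))`, and
`hseq i = h_i = K·h_{i-1} - (3D)^{(p-1)/2}·h_{i-2}` for `i ≥ 2` (note that
`h₂ = K·h₁ - (3D)^{(p-1)/2}·tr_B^G(N·e)` is the case `i = 2`). -/
def hseq (p : ℕ) [Fact p.Prime] (F : Type) [Field F] [CharP F p] :
    ℕ → MvPolynomial (Fin 4) F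
  | 0 => trBG p F (Npoly p F * epoly F)
  | 1 => Kpoly p F * trBG p F (Npoly p F * epoly F)
      - Dpoly F * trBG p F (Npoly p F * trP p F (X 3 ^ (p - 2)))
  | (n + 2) => Kpoly p F * hseq p F (n + 1) - (3 * Dpoly F) ^ ((p - 1) / 2) * hseq p F n


theorem act_mul_aux (p : ℕ) [Fact p.Prime] (F : Type) [Field F] [CharP F p]
    (g h : Matrix (Fin 2) (Fin 2) (ZMod p)) (f : MvPolynomial (Fin 4) F) :
    act p F h (act p F g f) = act p F (g * h) f := by
  have : (act p F h).comp (act p F g) = act p F (g * h) := by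
    apply MvPolynomial.algHom_ext
    intro i
    fin_cases i <;>
    · simp [act, Matrix.mul_apply, Fin.sum_univ_two, map_ofNat, MvPolynomial.algHom_C]
      ring
  rw [← this]; rfl

theorem act_one_aux (p : ℕ) [Fact p.Prime] (F : Type) [Field F] [CharP F p]
    (f : MvPolynomial (Fin 4) F) : act p F 1 f = f := by
  have : (act p F 1) = AlgHom.id F _ := by
    apply MvPolynomial.algHom_ext
    intro i
    fin_cases i <;> simp [act]
  rw [this]; rfl

theorem act_zero_X0 (p : ℕ) [Fact p.Prime] (F : Type) [Field F] [CharP F p]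
    (a b c d : ZMod p) : act p F !![a, b; c, d] (X 0) =
    C (ZMod.castHom (dvd_refl p) F d) ^ 3 * X 0 + 3 * C (ZMod.castHom (dvd_refl p) F d) ^ 2 * C (ZMod.castHom (dvd_refl p) F c) * X 1 + 3 * C (ZMod.castHom (dvd_refl p) F d) * C (ZMod.castHom (dvd_refl p) F c) ^ 2 * X 2 + C (ZMod.castHom (dvd_refl p) F c) ^ 3 * X 3 := by
  simp [act]

theorem act_X3 (p : ℕ) [Fact p.Prime] (F : Type) [Field F] [CharP F p]
    (a b c d : ZMod p) : act p F !![a, b; c, d] (X 3) =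
    C (ZMod.castHom (dvd_refl p) F b) ^ 3 * X 0 + 3 * C (ZMod.castHom (dvd_refl p) F b) ^ 2 * C (ZMod.castHom (dvd_refl p) F a) * X 1 + 3 * C (ZMod.castHom (dvd_refl p) F b) * C (ZMod.castHom (dvd_refl p) F a) ^ 2 * X 2 + C (ZMod.castHom (dvd_refl p) F a) ^ 3 * X 3 := by
  simp [act]

theorem mem_inv_iff (p : ℕ) [Fact p.Prime] (F : Type) [Field F] [CharP F p]
    (f : MvPolynomial (Fin 4) F) : f ∈ invariants p F ↔
    ∀ g : Matrix.SpecialLinearGroup (Fin 2) (ZMod p), act p F g.1 f = f := Iff.rfl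

/-- Invariance can be tested on lower unitriangular matrices and the Weyl element. -/
theorem mem_inv_of_gens (p : ℕ) [Fact p.Prime] (F : Type) [Field F] [CharP F p]
    (f : MvPolynomial (Fin 4) F)
    (h1 : ∀ t, act p F !![1, 0; t, 1] f = f)
    (h2 : act p F !![0, 1; -1, 0] f = f) : f ∈ invariants p F := by
  have h3 : ∀ t, act p F !![1, t; 0, 1] f = f := by
    intro t
    have e : !![1, t; 0, 1] = !![0, 1; -1, 0] * (!![1, 0; -t, 1] * (!![0, 1; -1, 0] *
      (!![0, 1; -1, 0] * (!![0, 1; -1, 0] : Matrix (Fin 2) (Fin 2) (ZMod p))))) := by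
      simp [Matrix.mul_fin_two]
    rw [e]
    simp only [← act_mul_aux, h1, h2]
  have key : ∀ a b c d : ZMod p, a * d - b * c = 1 → c ≠ 0 → act p F !![a, b; c, d] f = f := by
    intro a b c d hd hc
    have e : !![a, b; c, d] = !![1, (a - 1) / c; 0, 1] * (!![1, 0; c, 1] * !![1, (d - 1) / c; 0, 1]) := by
      have hb : b = (a * d - 1) / c := by field_simp; linear_combination -hd
      subst hb
      simp only [Matrix.mul_fin_two]
      congr! 2
      congr! 1
      · field_simp; ring_nf
      congr! 1
      · field_simp; ring
      congr! 1
      congr! 1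
      · field_simp; ring
      congr! 1
      field_simp; ring
    rw [e]
    simp only [← act_mul_aux, h1, h3]
  intro g
  obtain ⟨g, hg⟩ := g
  obtain ⟨a, b, c, d, rfl⟩ : ∃ a b c d, g = !![a, b; c, d] :=
    ⟨_, _, _, _, Matrix.eta_fin_two g⟩
  rw [Matrix.det_fin_two_of] at hg
  show act p F !![a, b; c, d] f = f
  by_cases hc : c = 0
  · subst hc
    have hd : d ≠ 0 := by rintro rfl; simp at hg
    have e : !![a, b; 0, d] = !![a + b, b; d, d] * !![1, 0; -1, 1] := by
      simp [Matrix.mul_fin_two]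
    rw [e, ← act_mul_aux, key _ _ _ _ (by linear_combination hg) hd, h1]
  · exact key _ _ _ _ hg hc

theorem trBG_inv (p : ℕ) [Fact p.Prime] (F : Type) [Field F] [CharP F p]
    (f : MvPolynomial (Fin 4) F)
    (hP : ∀ s, act p F !![1, s; 0, 1] f = f)
    (hR : ∀ w v, w * v = 1 → act p F !![w, 0; 0, v] f = f) : trBG p F f ∈ invariants p F := by
  apply mem_inv_of_gens
  · intro t
    unfold trBG
    rw [map_add, map_sum]
    refine congrArg₂ (· + ·) ?_ ?_
    · simp only [act_mul_aux]
      apply Fintype.sum_equiv (Equiv.addRight t)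
      intro s
      simp [Matrix.mul_fin_two]
    · have e : !![0, 1; -1, 0] * !![1, 0; t, 1] =
        !![1, -t; 0, 1] * (!![0, 1; -1, 0] : Matrix (Fin 2) (Fin 2) (ZMod p)) := by
        simp [Matrix.mul_fin_two]
      rw [act_mul_aux, e, ← act_mul_aux, hP]
  · unfold trBG
    rw [map_add, map_sum]
    simp only [act_mul_aux]
    rw [Fintype.sum_eq_add_sum_compl (0 : ZMod p), Fintype.sum_eq_add_sum_compl (0 : ZMod p)]
    have e0 : act p F (!![0, 1; -1, 0] * !![0, 1; -1, 0]) f = act p F !![1, 0; 0, 1] f := by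
      rw [hP]
      have : (!![0, 1; -1, 0] * !![0, 1; -1, 0] : Matrix (Fin 2) (Fin 2) (ZMod p)) =
        !![-1, 0; 0, -1] := by simp [Matrix.mul_fin_two]
      rw [this, hR _ _ (by ring)]
    have e1 : ∑ x ∈ ({0}ᶜ : Finset (ZMod p)), act p F (!![1, 0; x, 1] * !![0, 1; -1, 0]) f =
        ∑ x ∈ ({0}ᶜ : Finset (ZMod p)), act p F !![1, 0; x, 1] f := by
      refine Finset.sum_bij' (fun x _ => - x⁻¹) (fun x _ => - x⁻¹) ?_ ?_ ?_ ?_ ?_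
      · intro x hx; simpa using hx
      · intro x hx; simpa using hx
      · intro x hx; simp
      · intro x hx; simp
      · intro x hx
        have hx : x ≠ 0 := by simpa using hx
        have e : (!![1, 0; x, 1] * !![0, 1; -1, 0] : Matrix (Fin 2) (Fin 2) (ZMod p)) =
          !![1, x⁻¹; 0, 1] * (!![x⁻¹, 0; 0, x] * !![1, 0; -x⁻¹, 1]) := by
          simp [Matrix.mul_fin_two, hx]
        rw [e]
        simp only [← act_mul_aux]
        rw [hP, hR _ _ (by field_simp)]
    rw [e0, e1]
    have e2 : (!![1, 0; 0, 1] * !![0, 1; -1, 0] : Matrix (Fin 2) (Fin 2) (ZMod p)) =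
        !![0, 1; -1, 0] := by simp [Matrix.mul_fin_two]
    rw [e2]
    ring

theorem trG_inv (p : ℕ) [Fact p.Prime] (F : Type) [Field F] [CharP F p]
    (f : MvPolynomial (Fin 4) F) : trG p F f ∈ invariants p F := by
  intro g
  unfold trG
  rw [map_sum]
  simp only [act_mul_aux]
  apply Fintype.sum_equiv (Equiv.mulRight g)
  intro h
  simp

theorem D_inv (p : ℕ) [Fact p.Prime] (F : Type) [Field F] [CharP F p] :
    Dpoly F ∈ invariants p F := by
  apply mem_inv_of_gens
  · intro t
    simp only [Dpoly, act, map_add, map_sub, map_mul, map_pow, aeval_X, map_ofNat]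
    simp
    ring
  · simp only [Dpoly, act, map_add, map_sub, map_mul, map_pow, aeval_X, map_ofNat]
    simp
    ring

theorem e_P (p : ℕ) [Fact p.Prime] (F : Type) [Field F] [CharP F p] (t : ZMod p) :
    act p F !![1, t; 0, 1] (epoly F) = epoly F := by
  simp only [epoly, act, map_add, map_sub, map_mul, map_pow, aeval_X, map_ofNat]
  simp
  ring

theorem e_R (p : ℕ) [Fact p.Prime] (F : Type) [Field F] [CharP F p] (w v : ZMod p)
    (h : w * v = 1) :
    act p F !![w, 0; 0, v] (epoly F) = C (ZMod.castHom (dvd_refl p) F v) ^ 3 * epoly F := by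
  have h' : (C (ZMod.castHom (dvd_refl p) F w) : MvPolynomial (Fin 4) F) *
    C (ZMod.castHom (dvd_refl p) F v) = 1 := by
    rw [← C_mul, ← map_mul, h, map_one, C_1]
  simp only [epoly, act, map_add, map_sub, map_mul, map_pow, aeval_X, map_ofNat]
  simp at h' ⊢
  generalize (C (w.cast : F) : MvPolynomial (Fin 4) F) = W at *
  generalize (C (v.cast : F) : MvPolynomial (Fin 4) F) = V at *
  have h4 : V^3*W^3 = 1 := by linear_combination (V^2*W^2+V*W+1) * h'
  linear_combination (V ^ 3 * (2 * X 1 ^ 3 + X 0 * (X 3 * X 0 - 3 * X 2 * X 1))) * h4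

theorem N_P (p : ℕ) [Fact p.Prime] (F : Type) [Field F] [CharP F p] (t : ZMod p) :
    act p F !![1, t; 0, 1] (Npoly p F) = Npoly p F := by
  unfold Npoly
  rw [map_prod]
  simp only [act_mul_aux]
  apply Fintype.prod_equiv (Equiv.addRight t)
  intro s
  simp [add_comm]

theorem trP_P (p : ℕ) [Fact p.Prime] (F : Type) [Field F] [CharP F p] (t : ZMod p)
    (f : MvPolynomial (Fin 4) F) :
    act p F !![1, t; 0, 1] (trP p F f) = trP p F f := by
  unfold trP
  rw [map_sum]
  simp only [act_mul_aux]
  apply Fintype.sum_equiv (Equiv.addRight t)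
  intro s
  simp [add_comm]

theorem R_shift (p : ℕ) [Fact p.Prime] (F : Type) [Field F] [CharP F p] (w v : ZMod p)
    (h : w * v = 1) (s : ZMod p) :
    act p F !![w, 0; 0, v] (act p F !![1, s; 0, 1] (X 3)) =
      C (ZMod.castHom (dvd_refl p) F w) ^ 3 * act p F !![1, v * v * s; 0, 1] (X 3) := by
  have e : !![1, s; 0, 1] * !![w, 0; 0, v] = !![w, 0; 0, v] * !![1, v * v * s; 0, 1] := by
    simp [Matrix.mul_fin_two]
    linear_combination (-v * s) * h
  rw [act_mul_aux, e, ← act_mul_aux]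
  have : act p F !![w, 0; 0, v] (X 3) = C (ZMod.castHom (dvd_refl p) F w) ^ 3 * X 3 := by
    simp [act]
  rw [this, map_mul, map_pow, MvPolynomial.algHom_C, MvPolynomial.algebraMap_eq]

/-- Scaling by the square of a unit. -/
def sqEquiv (p : ℕ) [Fact p.Prime] (w v : ZMod p) (h : w * v = 1) : ZMod p ≃ ZMod p where
  toFun s := v * v * s
  invFun s := w * w * s
  left_inv s := by linear_combination (s * (w * v + 1)) * h
  right_inv s := by linear_combination (s * (w * v + 1)) * h

theorem castw_pow (p : ℕ) [Fact p.Prime] (F : Type) [Field F] [CharP F p] (w : ZMod p) :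
    (C (ZMod.castHom (dvd_refl p) F w) : MvPolynomial (Fin 4) F) ^ p =
      C (ZMod.castHom (dvd_refl p) F w) := by
  rw [← C_pow, ← map_pow, ZMod.pow_card]

theorem N_R (p : ℕ) [Fact p.Prime] (F : Type) [Field F] [CharP F p] (w v : ZMod p)
    (h : w * v = 1) :
    act p F !![w, 0; 0, v] (Npoly p F) = C (ZMod.castHom (dvd_refl p) F w) ^ 3 * Npoly p F := by
  unfold Npoly
  rw [map_prod]
  simp only [R_shift p F w v h]
  rw [Finset.prod_mul_distrib]
  refine congrArg₂ (· * ·) ?_ ?_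
  · rw [Finset.prod_const, Finset.card_univ, ZMod.card, ← pow_mul, mul_comm, pow_mul, castw_pow]
  · apply Fintype.prod_equiv (sqEquiv p w v h)
    intro s
    rfl

theorem trP_R (p : ℕ) [Fact p.Prime] (F : Type) [Field F] [CharP F p] (w v : ZMod p)
    (h : w * v = 1) (n : ℕ) :
    act p F !![w, 0; 0, v] (trP p F (X 3 ^ n)) =
      C (ZMod.castHom (dvd_refl p) F w) ^ (3 * n) * trP p F (X 3 ^ n) := by
  unfold trP
  rw [map_sum]
  simp only [map_pow, R_shift p F w v h, mul_pow, ← pow_mul]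
  rw [Finset.mul_sum]
  apply Fintype.sum_equiv (sqEquiv p w v h)
  intro s
  rfl

theorem Ne_inv (p : ℕ) [Fact p.Prime] (F : Type) [Field F] [CharP F p] :
    trBG p F (Npoly p F * epoly F) ∈ invariants p F := by
  apply trBG_inv
  · intro s
    rw [map_mul, N_P, e_P]
  · intro w v h
    rw [map_mul, N_R p F w v h, e_R p F w v h]
    have h' : (C (ZMod.castHom (dvd_refl p) F w) : MvPolynomial (Fin 4) F) *
      C (ZMod.castHom (dvd_refl p) F v) = 1 := by
      rw [← C_mul, ← map_mul, h, map_one, C_1]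
    calc _ = (C (ZMod.castHom (dvd_refl p) F w) * C (ZMod.castHom (dvd_refl p) F v)) ^ 3
        * (Npoly p F * epoly F) := by ring
      _ = _ := by rw [h']; ring

theorem NtrP_inv (p : ℕ) [Fact p.Prime] (hp : 3 < p) (F : Type) [Field F] [CharP F p] :
    trBG p F (Npoly p F * trP p F (X 3 ^ (p - 2))) ∈ invariants p F := by
  apply trBG_inv
  · intro s
    rw [map_mul, N_P, trP_P]
  · intro w v h
    rw [map_mul, N_R p F w v h, trP_R p F w v h]
    have hw : w ≠ 0 := by rintro rfl; simp at h
    have h' : (C (ZMod.castHom (dvd_refl p) F w) : MvPolynomial (Fin 4) F) ^ (p - 1) = 1 := by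
      rw [← C_pow, ← map_pow, ZMod.pow_card_sub_one_eq_one hw, map_one, C_1]
    have e : 3 + 3 * (p - 2) = (p - 1) * 3 := by omega
    calc _ = C (ZMod.castHom (dvd_refl p) F w) ^ (3 + 3 * (p - 2))
        * (Npoly p F * trP p F (X 3 ^ (p - 2))) := by ring
      _ = _ := by rw [e, pow_mul, h']; ring

theorem hseq_inv (p : ℕ) [Fact p.Prime] (hp : 3 < p) (F : Type) [Field F] [CharP F p] :
    ∀ n, hseq p F n ∈ invariants p F := by
  have hK : Kpoly p F ∈ invariants p F := neg_mem (trG_inv p F _)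
  have h3 : (3 * Dpoly F) ∈ invariants p F :=
    mul_mem (by
      have := (invariants p F).algebraMap_mem 3
      simpa using this) (D_inv p F)
  intro n
  induction n using Nat.twoStepInduction with
  | zero => simpa only [hseq] using Ne_inv p F
  | one =>
    simp only [hseq]
    exact sub_mem (mul_mem hK (Ne_inv p F)) (mul_mem (D_inv p F) (NtrP_inv p hp F))
  | more n h0 h1 =>
    simp only [hseq]
    exact sub_mem (mul_mem hK h1) (mul_mem (pow_mem h3 _) h0)


theorem sum_zmod_pow (p : ℕ) [Fact p.Prime] {L : Type*} [CommRing L] (ι : ZMod p →+* L) (n : ℕ)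
    (hn : n ≤ p - 1) : ∑ s : ZMod p, ι s ^ n = if n = p - 1 then -1 else 0 := by
  have hp1 : 1 < p := (Fact.out : p.Prime).one_lt
  have : ∑ s : ZMod p, s ^ n = if n = p - 1 then -1 else 0 := by
    split_ifs with h
    · subst h
      rw [Fintype.sum_eq_add_sum_compl (0 : ZMod p), zero_pow (by omega), zero_add]
      rw [Finset.sum_congr rfl (g := fun _ => (1 : ZMod p))
        (fun x hx => ZMod.pow_card_sub_one_eq_one (by simpa using hx))]
      rw [Finset.sum_const, Finset.card_compl, ZMod.card, Finset.card_singleton, nsmul_eq_mul,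
        Nat.cast_sub hp1.le]
      simp
    · exact FiniteField.sum_pow_lt_card_sub_one (ZMod p) n (by rw [ZMod.card]; omega)
  have h2 := congrArg ι this
  rw [map_sum] at h2
  simp only [map_pow] at h2
  rw [h2]
  split_ifs <;> simp

theorem sum_shift_small (p : ℕ) [Fact p.Prime] {L : Type*} [CommRing L] (ι : ZMod p →+* L) (y : L)
    (n : ℕ) (hn : n ≤ p - 1) : ∑ s : ZMod p, (ι s + y) ^ n = if n = p - 1 then -1 else 0 := by
  simp only [add_pow]
  rw [Finset.sum_comm]
  have : ∀ k ∈ Finset.range (n + 1), ∑ s : ZMod p, ι s ^ k * y ^ (n - k) * (n.choose k : L) =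
      if k = p - 1 then - (y ^ (n - k) * (n.choose k : L)) else 0 := by
    intro k hk
    rw [Finset.mem_range] at hk
    simp only [mul_assoc]
    rw [← Finset.sum_mul, sum_zmod_pow p ι k (by omega)]
    split_ifs <;> simp
  rw [Finset.sum_congr rfl this, Finset.sum_ite_eq']
  by_cases h : n = p - 1
  · subst h; simp
  · rw [if_neg h, if_neg]
    simp; omega

theorem cast_p_zero (p : ℕ) [Fact p.Prime] {L : Type*} [CommRing L] (ι : ZMod p →+* L) :
    ((p : ℕ) : L) = 0 := by
  have := congrArg ι (CharP.cast_eq_zero (ZMod p) p)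
  rwa [map_natCast, map_zero] at this

theorem sum_shift_rec (p : ℕ) [Fact p.Prime] {L : Type*} [CommRing L] (ι : ZMod p →+* L) (y : L)
    (n : ℕ) : ∑ s : ZMod p, (ι s + y) ^ (n + p) = ∑ s : ZMod p, (ι s + y) ^ (n + 1)
      + (y ^ p - y) * ∑ s : ZMod p, (ι s + y) ^ n := by
  have hL : ((p : ℕ) : L) = 0 := cast_p_zero p ι
  rw [Finset.mul_sum, ← Finset.sum_add_distrib]
  refine Finset.sum_congr rfl fun s _ => ?_
  have h : (ι s + y) ^ p = ι s + y ^ p := by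
    obtain ⟨r, hr⟩ := exists_add_pow_prime_eq (Fact.out : p.Prime) (ι s) y
    rw [hr, hL, ← map_pow, ZMod.pow_card]
    ring
  rw [pow_add, h]
  ring


theorem sum_shift (p : ℕ) [Fact p.Prime] {L : Type*} [CommRing L] (ι : ZMod p →+* L) (y : L)
    (hp : 3 < p) (m k : ℕ) (hm : p = 2 * m + 1) (hk : k ≤ p - 1) :
    ∑ s : ZMod p, ((ι s + y) ^ 2) ^ k =
      (if k = m then -1 else 0) + (if k = p - 1 then -1 else 0) := by
  simp only [← pow_mul]
  by_cases h : 2 * k ≤ p - 1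
  · rw [sum_shift_small p ι y _ h, if_neg (show ¬ k = p - 1 by omega), add_zero]
    congr 1
    simp only [eq_iff_iff]; omega
  · obtain ⟨n, hn⟩ : ∃ n, 2 * k = n + p := ⟨2 * k - p, by omega⟩
    rw [hn, sum_shift_rec, sum_shift_small p ι y _ (by omega),
      sum_shift_small p ι y _ (by omega), if_neg (show ¬ n = p - 1 by omega),
      if_neg (show ¬ k = m by omega), mul_zero, add_zero, zero_add]
    congr 1
    simp only [eq_iff_iff]; omega

theorem choose_p1 (p : ℕ) [Fact p.Prime] {L : Type*} [CommRing L] (ι : ZMod p →+* L)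
    (k : ℕ) (hk : k < p) : ((p - 1).choose k : L) = (-1) ^ k := by
  have hL := cast_p_zero p ι
  induction k with
  | zero => simp
  | succ k ih =>
    have h1 : p.choose (k + 1) = (p - 1).choose k + (p - 1).choose (k + 1) := by
      obtain ⟨q, rfl⟩ : ∃ q, p = q + 1 := ⟨p - 1, by omega⟩
      rw [Nat.choose_succ_succ]; rfl
    obtain ⟨c, hc⟩ := (Fact.out : p.Prime).dvd_choose_self (Nat.succ_ne_zero k) hk
    have h2 := congrArg (Nat.cast : ℕ → L) h1
    rw [hc] at h2
    push_cast at h2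
    rw [hL, ih (by omega)] at h2
    rw [pow_succ]
    linear_combination -h2

theorem choose_p2 (p : ℕ) [Fact p.Prime] {L : Type*} [CommRing L] (ι : ZMod p →+* L)
    (hp : 3 < p) (k : ℕ) (hk : k < p) : ((p - 2).choose k : L) = (-1) ^ k * (k + 1) := by
  induction k with
  | zero => simp
  | succ k ih =>
    have h1 : (p - 1).choose (k + 1) = (p - 2).choose k + (p - 2).choose (k + 1) := by
      obtain ⟨q, rfl⟩ : ∃ q, p = q + 2 := ⟨p - 2, by omega⟩
      show (q + 1).choose (k + 1) = _
      rw [Nat.choose_succ_succ]; rfl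
    have h2 := congrArg (Nat.cast : ℕ → L) h1
    push_cast at h2
    rw [choose_p1 p ι _ hk, ih (by omega)] at h2
    push_cast
    rw [pow_succ] at h2 ⊢
    linear_combination -h2

theorem sum_q_expand (p : ℕ) [Fact p.Prime] {L : Type*} [CommRing L] (ι : ZMod p →+* L)
    (hp : 3 < p) (m n : ℕ) (hm : p = 2 * m + 1) (hn : n ≤ p - 1) (hmn : m ≤ n) (c y δ : L) :
    ∑ s : ZMod p, (c * (ι s + y) ^ 2 + δ) ^ n =
      - (c ^ m * δ ^ (n - m) * (n.choose m : L)) - (if n = p - 1 then c ^ n else 0) := by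
  simp only [add_pow (c * _), mul_pow]
  rw [Finset.sum_comm]
  have : ∀ k ∈ Finset.range (n + 1),
      ∑ s : ZMod p, c ^ k * ((ι s + y) ^ 2) ^ k * δ ^ (n - k) * (n.choose k : L) =
      (if k = m then - (c ^ k * δ ^ (n - k) * (n.choose k : L)) else 0) +
      (if k = p - 1 then - (c ^ k * δ ^ (n - k) * (n.choose k : L)) else 0) := by
    intro k hk
    rw [Finset.mem_range] at hk
    rw [← Finset.sum_mul, ← Finset.sum_mul, ← Finset.mul_sum,
      sum_shift p ι y hp m k hm (by omega)]
    split_ifs <;> ring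
  rw [Finset.sum_congr rfl this, Finset.sum_add_distrib, Finset.sum_ite_eq', Finset.sum_ite_eq',
    if_pos (by simp; omega)]
  by_cases h : n = p - 1
  · subst h
    rw [if_pos (by simp), if_pos rfl]
    simp; ring
  · rw [if_neg (by simp; omega), if_neg h]
    ring

theorem four_pow (p : ℕ) [Fact p.Prime] {L : Type*} [CommRing L] (ι : ZMod p →+* L)
    (hp : 3 < p) (m : ℕ) (hm : p = 2 * m + 1) : (4 : L) ^ m = 1 := by
  have h2 : (2 : ZMod p) ≠ 0 := by
    intro h
    have h' : ((2 : ℕ) : ZMod p) = 0 := by exact_mod_cast h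
    rw [ZMod.natCast_eq_zero_iff] at h'
    have := Nat.le_of_dvd (by norm_num) h'
    omega
  have h := ZMod.pow_card_sub_one_eq_one h2
  have e : p - 1 = 2 * m := by omega
  rw [e, pow_mul] at h
  have := congrArg ι h
  simp only [map_pow, map_ofNat, map_one] at this
  rw [← this]; norm_num

theorem sum_q_field1 (p : ℕ) [Fact p.Prime] {L : Type*} [Field L] (ι : ZMod p →+* L)
    (hp : 3 < p) (m : ℕ) (hm : p = 2 * m + 1) (a b c : L) (hc : c ≠ 0) :
    ∑ s : ZMod p, (c * ι s ^ 2 + b * ι s + a) ^ (p - 1) =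
      - (b ^ 2 - 4 * a * c) ^ m - c ^ (p - 1) := by
  have h4 := four_pow p ι hp m hm
  have h40 : (4 : L) ≠ 0 := by
    intro h; rw [h, zero_pow (by omega)] at h4; exact zero_ne_one h4
  have h20 : (2 : L) ≠ 0 := by
    intro h; apply h40; linear_combination 2 * h
  have e : ∀ s, c * ι s ^ 2 + b * ι s + a =
      c * (ι s + b / (2 * c)) ^ 2 + (- (b ^ 2 - 4 * a * c) / (4 * c)) := by
    intro s; field_simp; ring
  simp only [e]
  rw [sum_q_expand p ι hp m (p - 1) hm le_rfl (by omega), choose_p1 p ι _ (by omega), if_pos rfl]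
  have e2 : p - 1 - m = m := by omega
  rw [e2, ← mul_pow, ← mul_pow]
  have e3 : c * (- (b ^ 2 - 4 * a * c) / (4 * c)) * -1 = (b ^ 2 - 4 * a * c) / 4 := by
    field_simp
  rw [e3, div_pow, h4, div_one]

theorem sum_q_field2 (p : ℕ) [Fact p.Prime] {L : Type*} [Field L] (ι : ZMod p →+* L)
    (hp : 3 < p) (m : ℕ) (hm : p = 2 * m + 1) (a b c : L) (hc : c ≠ 0) :
    ∑ s : ZMod p, (c * ι s ^ 2 + b * ι s + a) ^ (p - 2) =
      2 * c * (b ^ 2 - 4 * a * c) ^ (m - 1) := by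
  have h4 := four_pow p ι hp m hm
  have h40 : (4 : L) ≠ 0 := by
    intro h; rw [h, zero_pow (by omega)] at h4; exact zero_ne_one h4
  have h20 : (2 : L) ≠ 0 := by
    intro h; apply h40; linear_combination 2 * h
  have e : ∀ s, c * ι s ^ 2 + b * ι s + a =
      c * (ι s + b / (2 * c)) ^ 2 + (- (b ^ 2 - 4 * a * c) / (4 * c)) := by
    intro s; field_simp; ring
  simp only [e]
  rw [sum_q_expand p ι hp m (p - 2) hm (by omega) (by omega), choose_p2 p ι hp _ (by omega),
    if_neg (by omega)]
  have hL := cast_p_zero p ι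
  rw [hm] at hL
  push_cast at hL
  obtain ⟨n, rfl⟩ : ∃ n, m = n + 1 := ⟨m - 1, by omega⟩
  have e2 : p - 2 - (n + 1) = n := by omega
  rw [e2, Nat.add_sub_cancel]
  have e3 : c * (- (b ^ 2 - 4 * a * c) / (4 * c)) * -1 = (b ^ 2 - 4 * a * c) / 4 := by
    field_simp
  generalize (- (b ^ 2 - 4 * a * c) / (4 * c)) = δ at *
  have e4 : b ^ 2 - 4 * a * c = 4 * (c * δ * -1) := by rw [e3]; field_simp
  rw [e4, mul_pow, mul_pow, mul_pow]
  push_cast at hL ⊢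
  have h5 : (n : L) + 1 + 1 = 2 * 4 ^ n := by
    apply mul_left_cancel₀ h20
    rw [pow_succ] at h4
    linear_combination hL - h4
  rw [h5]
  ring

theorem sum_q1 (p : ℕ) [Fact p.Prime] {R : Type*} [CommRing R] [IsDomain R] (ι : ZMod p →+* R)
    (hp : 3 < p) (m : ℕ) (hm : p = 2 * m + 1) (a b c : R) (hc : c ≠ 0) :
    ∑ s : ZMod p, (c * ι s ^ 2 + b * ι s + a) ^ (p - 1) =
      - (b ^ 2 - 4 * a * c) ^ m - c ^ (p - 1) := by
  apply IsFractionRing.injective R (FractionRing R)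
  have := sum_q_field1 p ((algebraMap R (FractionRing R)).comp ι) hp m hm
    (algebraMap R (FractionRing R) a) (algebraMap R (FractionRing R) b)
    (algebraMap R (FractionRing R) c)
    (fun h => hc (IsFractionRing.injective R (FractionRing R) (by rw [h, map_zero])))
  simpa [map_ofNat] using this

theorem sum_q2 (p : ℕ) [Fact p.Prime] {R : Type*} [CommRing R] [IsDomain R] (ι : ZMod p →+* R)
    (hp : 3 < p) (m : ℕ) (hm : p = 2 * m + 1) (a b c : R) (hc : c ≠ 0) :
    ∑ s : ZMod p, (c * ι s ^ 2 + b * ι s + a) ^ (p - 2) =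
      2 * c * (b ^ 2 - 4 * a * c) ^ (m - 1) := by
  apply IsFractionRing.injective R (FractionRing R)
  have := sum_q_field2 p ((algebraMap R (FractionRing R)).comp ι) hp m hm
    (algebraMap R (FractionRing R) a) (algebraMap R (FractionRing R) b)
    (algebraMap R (FractionRing R) c)
    (fun h => hc (IsFractionRing.injective R (FractionRing R) (by rw [h, map_zero])))
  simpa [map_ofNat] using this


theorem sum_lin (p : ℕ) [Fact p.Prime] {L : Type*} [CommRing L] (ι : ZMod p →+* L) (x y : L) :
    ∑ s : ZMod p, (ι s * x + y) ^ (p - 1) = - x ^ (p - 1) := by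
  simp only [add_pow, mul_pow]
  rw [Finset.sum_comm]
  have : ∀ k ∈ Finset.range (p - 1 + 1),
      ∑ s : ZMod p, ι s ^ k * x ^ k * y ^ (p - 1 - k) * ((p - 1).choose k : L) =
      if k = p - 1 then - (x ^ k * (y ^ (p - 1 - k) * ((p - 1).choose k : L))) else 0 := by
    intro k hk
    rw [Finset.mem_range] at hk
    simp only [mul_assoc]
    rw [← Finset.sum_mul, sum_zmod_pow p ι k (by omega)]
    split_ifs <;> simp
  rw [Finset.sum_congr rfl this, Finset.sum_ite_eq']
  simp

/-- The structure map from the prime field to the polynomial ring. -/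
def io (p : ℕ) [Fact p.Prime] (F : Type) [Field F] [CharP F p] : ZMod p →+* MvPolynomial (Fin 4) F :=
  (C : F →+* MvPolynomial (Fin 4) F).comp (ZMod.castHom (dvd_refl p) F)

theorem io_eq (p : ℕ) [Fact p.Prime] (F : Type) [Field F] [CharP F p] (s : ZMod p) :
    (C (ZMod.castHom (dvd_refl p) F s) : MvPolynomial (Fin 4) F) = io p F s := rfl

/-- The coset representatives. -/
def rep (p : ℕ) : Option (ZMod p) → Matrix (Fin 2) (Fin 2) (ZMod p)
  | none => !![0, 1; -1, 0]
  | some s => !![1, 0; s, 1]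

theorem trBG_rep (p : ℕ) [Fact p.Prime] (F : Type) [Field F] [CharP F p]
    (f : MvPolynomial (Fin 4) F) : trBG p F f = ∑ o : Option (ZMod p), act p F (rep p o) f := by
  rw [Fintype.sum_option, add_comm]
  rfl

/-- Bruhat style parametrisation of the group. -/
def bru (p : ℕ) [Fact p.Prime] (x : Option (ZMod p) × (ZMod p)ˣ × ZMod p) :
    Matrix.SpecialLinearGroup (Fin 2) (ZMod p) :=
  ⟨!![1, x.2.2; 0, 1] * (!![(x.2.1 : ZMod p), 0; 0, (x.2.1 : ZMod p)⁻¹] * rep p x.1), by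
    rw [Matrix.det_mul, Matrix.det_mul]
    rcases x with ⟨_ | s, w, t⟩ <;> simp [-ZMod.inv_coe_unit, rep, Matrix.det_fin_two_of]⟩

theorem bru_none (p : ℕ) [Fact p.Prime] (w : (ZMod p)ˣ) (t : ZMod p) :
    (bru p (none, w, t)).1 = !![-(t * (w : ZMod p)⁻¹), w; -(w : ZMod p)⁻¹, 0] := by
  simp [-ZMod.inv_coe_unit, bru, rep]

theorem bru_some (p : ℕ) [Fact p.Prime] (s : ZMod p) (w : (ZMod p)ˣ) (t : ZMod p) :
    (bru p (some s, w, t)).1 = !![w + t * ((w : ZMod p)⁻¹ * s), t * (w : ZMod p)⁻¹;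
      (w : ZMod p)⁻¹ * s, (w : ZMod p)⁻¹] := by
  simp [-ZMod.inv_coe_unit, bru, rep]

theorem bru_bij (p : ℕ) [Fact p.Prime] : Function.Bijective (bru p) := by
  constructor
  · rintro ⟨o, w, t⟩ ⟨o', w', t'⟩ h
    have h := congrArg Subtype.val h
    have h00 := congrFun (congrFun h 0) 0
    have h01 := congrFun (congrFun h 0) 1
    have h10 := congrFun (congrFun h 1) 0
    have h11 := congrFun (congrFun h 1) 1
    rcases o with _ | s <;> rcases o' with _ | s'
    · rw [bru_none, bru_none] at h00 h01
      simp [-ZMod.inv_coe_unit] at h00 h01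
      have : w = w' := Units.ext h01
      subst this
      simp [-ZMod.inv_coe_unit] at h00
      simp [h00]
    · rw [bru_none, bru_some] at h11
      simp [-ZMod.inv_coe_unit] at h11
      exact absurd h11.symm w'.ne_zero
    · rw [bru_none, bru_some] at h11
      simp [-ZMod.inv_coe_unit] at h11
    · rw [bru_some, bru_some] at h01 h10 h11
      simp [-ZMod.inv_coe_unit] at h01 h10 h11
      have : w = w' := Units.ext h11
      subst this
      simp [-ZMod.inv_coe_unit] at h01 h10
      simp [h01, h10]
  · rintro ⟨g, hg⟩
    obtain ⟨a, b, c, d, rfl⟩ : ∃ a b c d, g = !![a, b; c, d] :=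
      ⟨_, _, _, _, Matrix.eta_fin_two g⟩
    rw [Matrix.det_fin_two_of] at hg
    by_cases hd : d = 0
    · subst hd
      have hb : b ≠ 0 := by rintro rfl; simp at hg
      refine ⟨(none, Units.mk0 b hb, -(a * b)), Subtype.ext ?_⟩
      rw [bru_none]
      have hc : c = - b⁻¹ := by field_simp; linear_combination -hg
      subst hc
      simp [hb]
    · refine ⟨(some (c / d), (Units.mk0 d hd)⁻¹, b / d), Subtype.ext ?_⟩
      rw [bru_some]
      have ha : a = d⁻¹ + b / d * c := by field_simp; linear_combination hg
      subst ha
      simp [hd]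
      field_simp
      simp

theorem trG_bru (p : ℕ) [Fact p.Prime] (F : Type) [Field F] [CharP F p]
    (f : MvPolynomial (Fin 4) F) : trG p F f =
      trBG p F (∑ w : (ZMod p)ˣ, act p F !![(w : ZMod p), 0; 0, (w : ZMod p)⁻¹] (trP p F f)) := by
  rw [trBG_rep]
  unfold trG trP
  rw [← Fintype.sum_bijective (bru p) (bru_bij p) (fun x => act p F (bru p x).1 f) _
    (fun _ => rfl)]
  simp only [map_sum, Fintype.sum_prod_type, act_mul_aux]
  refine Finset.sum_congr rfl fun o _ => Finset.sum_congr rfl fun w _ =>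
    Finset.sum_congr rfl fun s _ => ?_
  rw [mul_assoc]
  rfl

theorem K_eq (p : ℕ) [Fact p.Prime] (hp : 3 < p) (F : Type) [Field F] [CharP F p] :
    Kpoly p F = - trBG p F (X 0 ^ (p - 1)) := by
  unfold Kpoly
  rw [trG_bru]
  have h1 : trP p F (X 1 ^ (p - 1)) = - X 0 ^ (p - 1) := by
    rw [← sum_lin p (io p F) (X 0) (X 1)]
    unfold trP
    refine Finset.sum_congr rfl fun s _ => ?_
    rw [map_pow]
    congr 1
    simp [act, io]
  rw [h1]
  have h2 : ∀ w : (ZMod p)ˣ, act p F !![(w : ZMod p), 0; 0, (w : ZMod p)⁻¹] (- X 0 ^ (p - 1)) =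
      - X 0 ^ (p - 1) := by
    intro w
    rw [map_neg, map_pow, act_zero_X0]
    simp only [io_eq, map_zero]
    have : io p F (w : ZMod p)⁻¹ ^ (p - 1) = 1 := by
      rw [← map_pow, ZMod.pow_card_sub_one_eq_one (inv_ne_zero w.ne_zero), map_one]
    rw [show io p F (w : ZMod p)⁻¹ ^ 3 * X 0 + 3 * io p F (w : ZMod p)⁻¹ ^ 2 * 0 * X 1 +
      3 * io p F (w : ZMod p)⁻¹ * 0 ^ 2 * X 2 + 0 ^ 3 * X 3 = io p F (w : ZMod p)⁻¹ ^ 3 * X 0 by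
        ring, mul_pow, ← pow_mul, mul_comm 3, pow_mul, this]
    ring
  simp only [h2]
  rw [Finset.sum_const, Finset.card_univ, ZMod.card_units, nsmul_eq_mul,
    Nat.cast_sub (by omega), cast_p_zero p (io p F)]
  congr 2
  simp

/-- Setting `a₀ = 0`. -/
def pr (F : Type) [Field F] : MvPolynomial (Fin 4) F →ₐ[F] MvPolynomial (Fin 4) F :=
  aeval ![0, X 1, X 2, X 3]

theorem pr_X0 (F : Type) [Field F] : pr F (X 0) = 0 := by simp [pr]
theorem pr_X1 (F : Type) [Field F] : pr F (X 1) = X 1 := by simp [pr]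
theorem pr_X2 (F : Type) [Field F] : pr F (X 2) = X 2 := by simp [pr]
theorem pr_X3 (F : Type) [Field F] : pr F (X 3) = X 3 := by simp [pr]
theorem pr_io (p : ℕ) [Fact p.Prime] (F : Type) [Field F] [CharP F p] (s : ZMod p) :
    pr F (io p F s) = io p F s := by
  show pr F (C _) = C _
  rw [MvPolynomial.algHom_C]; rfl

theorem pr_dvd (F : Type) [Field F] (f : MvPolynomial (Fin 4) F) : X 0 ∣ f - pr F f := by
  induction f using MvPolynomial.induction_on with
  | C a => rw [MvPolynomial.algHom_C]; simp
  | add f g hf hg =>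
    rw [map_add, add_sub_add_comm]
    exact dvd_add hf hg
  | mul_X f i hf =>
    have hi : (X 0 : MvPolynomial (Fin 4) F) ∣ X i - pr F (X i) := by
      fin_cases i <;> simp [pr]
    rw [map_mul]
    have : f * X i - pr F f * pr F (X i) = (f - pr F f) * X i + pr F f * (X i - pr F (X i)) := by
      ring
    rw [this]
    exact dvd_add (dvd_mul_of_dvd_left hf _) (dvd_mul_of_dvd_right hi _)

theorem coeff_pr (F : Type) [Field F] (f : MvPolynomial (Fin 4) F) (d : Fin 4 →₀ ℕ)
    (hd : d 0 = 0) : coeff d f = coeff d (pr F f) := by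
  obtain ⟨g, hg⟩ := pr_dvd F f
  rw [sub_eq_iff_eq_add] at hg
  have := congrArg (coeff d) hg
  rw [coeff_add, coeff_X_mul', if_neg (by simp [hd]), zero_add] at this
  exact this

/-- The restriction of `N` to `a₀ = 0`. -/
def Nb (p : ℕ) [Fact p.Prime] (F : Type) [Field F] [CharP F p] : MvPolynomial (Fin 4) F :=
  ∏ s : ZMod p, (3 * X 1 * io p F s ^ 2 + 3 * X 2 * io p F s + X 3)

theorem pr_shift (p : ℕ) [Fact p.Prime] (F : Type) [Field F] [CharP F p] (s : ZMod p) :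
    pr F (act p F !![1, s; 0, 1] (X 3)) =
      3 * X 1 * io p F s ^ 2 + 3 * X 2 * io p F s + X 3 := by
  rw [act_X3]
  simp only [io_eq, map_add, map_mul, map_pow, pr_io, pr_X0, pr_X1, pr_X2, pr_X3, map_one,
    map_ofNat]
  ring

theorem pr_N (p : ℕ) [Fact p.Prime] (F : Type) [Field F] [CharP F p] :
    pr F (Npoly p F) = Nb p F := by
  unfold Npoly Nb
  rw [map_prod]
  simp only [pr_shift]

theorem pr_trBG_N (p : ℕ) [Fact p.Prime] (F : Type) [Field F] [CharP F p]
    (f : MvPolynomial (Fin 4) F) : pr F (trBG p F (Npoly p F * f)) = Nb p F * pr F f := by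
  unfold trBG
  have h0 : pr F (act p F !![0, 1; -1, 0] (Npoly p F)) = 0 := by
    unfold Npoly
    rw [map_prod, map_prod]
    apply Finset.prod_eq_zero (Finset.mem_univ 0)
    rw [act_mul_aux]
    have : (!![1, 0; 0, 1] * !![0, 1; -1, 0] : Matrix (Fin 2) (Fin 2) (ZMod p)) =
        !![0, 1; -1, 0] := by simp
    rw [this, act_X3]
    simp [pr]
  have h1 : ∀ s : ZMod p, s ≠ 0 → pr F (act p F !![1, 0; s, 1] (Npoly p F)) = 0 := by
    intro s hs
    unfold Npoly
    rw [map_prod, map_prod]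
    apply Finset.prod_eq_zero (Finset.mem_univ (-s⁻¹))
    rw [act_mul_aux]
    have : (!![1, -s⁻¹; 0, 1] * !![1, 0; s, 1] : Matrix (Fin 2) (Fin 2) (ZMod p)) =
        !![0, -s⁻¹; s, 1] := by simp [hs]
    rw [this, act_X3]
    simp only [io_eq, map_add, map_mul, map_pow, pr_io, pr_X0, pr_X1, pr_X2, pr_X3, map_zero,
      map_ofNat]
    ring
  rw [map_add, map_mul (act p F _), map_mul, h0, zero_mul, add_zero, map_sum,
    Fintype.sum_eq_single (0 : ZMod p)]
  · have : (!![1, 0; 0, 1] : Matrix (Fin 2) (Fin 2) (ZMod p)) = 1 := Matrix.one_fin_two.symm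
    rw [this, act_one_aux, map_mul, pr_N]
  · intro s hs
    rw [map_mul, map_mul, h1 s hs, zero_mul]

theorem three_ne (p : ℕ) [Fact p.Prime] (hp : 3 < p) (F : Type) [Field F] [CharP F p] :
    (3 : F) ≠ 0 := by
  have := CharP.cast_eq_zero_iff F p 3
  intro h
  have h' := this.1 (by exact_mod_cast h)
  have := Nat.le_of_dvd (by norm_num) h'
  omega

theorem two_ne (p : ℕ) [Fact p.Prime] (hp : 3 < p) (F : Type) [Field F] [CharP F p] :
    (2 : F) ≠ 0 := by
  have := CharP.cast_eq_zero_iff F p 2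
  intro h
  have h' := this.1 (by exact_mod_cast h)
  have := Nat.le_of_dvd (by norm_num) h'
  omega

theorem three_pow (p : ℕ) [Fact p.Prime] (hp : 3 < p) (F : Type) [Field F] [CharP F p] :
    (3 : MvPolynomial (Fin 4) F) ^ (p - 1) = 1 := by
  have h2 := three_ne p hp (ZMod p)
  have h := congrArg (io p F) (ZMod.pow_card_sub_one_eq_one h2)
  simpa [map_ofNat] using h

theorem pr_K (p : ℕ) [Fact p.Prime] (hp : 3 < p) (F : Type) [Field F] [CharP F p]
    (m : ℕ) (hm : p = 2 * m + 1) :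
    pr F (Kpoly p F) = X 1 ^ (p - 1) + (9 * X 2 ^ 2 - 12 * X 3 * X 1) ^ m := by
  rw [K_eq p hp]
  unfold trBG
  have hS := sum_q1 p (io p F) hp m hm (3 * X 1) (3 * X 2) (X 3) (X_ne_zero 3)
  have h1 : ∀ s : ZMod p, pr F (act p F !![1, 0; s, 1] (X 0 ^ (p - 1))) =
      (X 3 * io p F s ^ 2 + 3 * X 2 * io p F s + 3 * X 1) ^ (p - 1) -
      (if s = 0 then X 1 ^ (p - 1) else 0) := by
    intro s
    rw [map_pow, map_pow, act_zero_X0]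
    simp only [io_eq, map_add, map_mul, map_pow, pr_io, pr_X0, pr_X1, pr_X2, pr_X3, map_one,
      map_ofNat]
    split_ifs with h
    · subst h
      simp only [map_zero]
      rw [show (1 : MvPolynomial (Fin 4) F) ^ 3 * 0 + 3 * 1 ^ 2 * 0 * X 1 + 3 * 1 * 0 ^ 2 * X 2
        + 0 ^ 3 * X 3 = 0 by ring, show (X 3 * 0 ^ 2 + 3 * X 2 * 0 + 3 * X 1 :
        MvPolynomial (Fin 4) F) = 3 * X 1 by ring, zero_pow (by omega), mul_pow,
        three_pow p hp]
      ring
    · have : io p F s ^ (p - 1) = 1 := by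
        rw [← map_pow, ZMod.pow_card_sub_one_eq_one h, map_one]
      rw [show (1 : MvPolynomial (Fin 4) F) ^ 3 * 0 + 3 * 1 ^ 2 * io p F s * X 1
        + 3 * 1 * io p F s ^ 2 * X 2 + io p F s ^ 3 * X 3 =
        io p F s * (X 3 * io p F s ^ 2 + 3 * X 2 * io p F s + 3 * X 1) by ring, mul_pow, this]
      ring
  have h2 : pr F (act p F !![0, 1; -1, 0] (X 0 ^ (p - 1))) = X 3 ^ (p - 1) := by
    rw [map_pow, map_pow, act_zero_X0]
    simp only [io_eq, map_add, map_mul, map_pow, pr_io, pr_X0, pr_X1, pr_X2, pr_X3, map_one,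
      map_ofNat, map_zero, map_neg]
    rw [show (0 : MvPolynomial (Fin 4) F) ^ 3 * 0 + 3 * 0 ^ 2 * -1 * X 1 + 3 * 0 * (-1) ^ 2 * X 2
        + (-1) ^ 3 * X 3 = - X 3 by ring, Even.neg_pow ⟨m, by omega⟩]
  rw [map_neg, map_add, map_sum, h2]
  simp only [h1]
  rw [Finset.sum_sub_distrib, hS, Finset.sum_ite_eq', if_pos (Finset.mem_univ _)]
  ring

theorem pr_hseq (p : ℕ) [Fact p.Prime] (hp : 3 < p) (F : Type) [Field F] [CharP F p] (n : ℕ) :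
    pr F (hseq p F n) = X 1 ^ ((p - 1) * n) * (Nb p F * (2 * X 1 ^ 3)) := by
  obtain ⟨m, hm⟩ : ∃ m, p = 2 * m + 1 :=
    (Fact.out : p.Prime).odd_of_ne_two (by omega)
  have hK := pr_K p hp F m hm
  have h0 : pr F (hseq p F 0) = Nb p F * (2 * X 1 ^ 3) := by
    simp only [hseq]
    rw [pr_trBG_N]
    congr 1
    simp only [epoly, map_add, map_sub, map_mul, map_pow, pr_X0, pr_X1, pr_X2, pr_X3, map_ofNat]
    ring
  have hD : pr F (Dpoly F) = X 1 ^ 2 * (3 * X 2 ^ 2 - 4 * X 3 * X 1) := by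
    simp only [Dpoly, map_add, map_sub, map_mul, map_pow, pr_X0, pr_X1, pr_X2, pr_X3, map_ofNat]
    ring
  have hD2 : pr F ((3 * Dpoly F) ^ ((p - 1) / 2)) =
      X 1 ^ (p - 1) * (9 * X 2 ^ 2 - 12 * X 3 * X 1) ^ m := by
    rw [map_pow, map_mul, hD, map_ofNat, show (p - 1) / 2 = m by omega,
      show p - 1 = 2 * m by omega, pow_mul, ← mul_pow]
    congr 1
    ring
  have hc : (3 * X 1 : MvPolynomial (Fin 4) F) ≠ 0 := by
    apply mul_ne_zero _ (X_ne_zero 1)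
    have := three_ne p hp F
    intro h
    apply this
    have h2 : (C (3 : F) : MvPolynomial (Fin 4) F) = 0 := by rw [map_ofNat, h]
    simpa using h2
  have hS := sum_q2 p (io p F) hp m hm (X 3) (3 * X 2) (3 * X 1) hc
  have h1 : pr F (hseq p F 1) = X 1 ^ (p - 1) * (Nb p F * (2 * X 1 ^ 3)) := by
    have e : pr F (trP p F (X 3 ^ (p - 2))) =
        2 * (3 * X 1) * ((3 * X 2) ^ 2 - 4 * X 3 * (3 * X 1)) ^ (m - 1) := by
      rw [← hS]
      unfold trP
      rw [map_sum]
      simp only [map_pow, pr_shift]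
    have h0' := h0
    simp only [hseq] at h0' ⊢
    rw [map_sub, map_mul, map_mul, h0', hK, hD, pr_trBG_N, e]
    obtain ⟨n, rfl⟩ : ∃ n, m = n + 1 := ⟨m - 1, by omega⟩
    rw [show (3 * X 2) ^ 2 - 4 * X 3 * (3 * X 1) =
      (9 * X 2 ^ 2 - 12 * X 3 * X 1 : MvPolynomial (Fin 4) F) by ring, Nat.add_sub_cancel, pow_succ]
    ring
  induction n using Nat.twoStepInduction with
  | zero => rw [h0]; ring
  | one => rw [h1]; ring
  | more n ih0 ih1 =>
    simp only [hseq]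
    rw [map_sub, map_mul, map_mul, hK, hD2, ih0, ih1]
    ring

theorem act_hom (p : ℕ) [Fact p.Prime] (F : Type) [Field F] [CharP F p]
    (g : Matrix (Fin 2) (Fin 2) (ZMod p)) (f : MvPolynomial (Fin 4) F) (n : ℕ)
    (hf : f.IsHomogeneous n) : (act p F g f).IsHomogeneous n := by
  have := hf.aeval (n := 1) (g := fun i => act p F g (X i)) (S := F) (τ := Fin 4) ?_
  · rw [one_mul] at this
    convert this using 1
    exact DFunLike.congr_fun (aeval_unique (act p F g)) f
  · have key : ∀ (x0 x1 x2 x3 : F), (C x0 * X 0 + C x1 * X 1 + C x2 * X 2 + C x3 * X 3 :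
        MvPolynomial (Fin 4) F).IsHomogeneous 1 := fun x0 x1 x2 x3 =>
      (((isHomogeneous_C_mul_X x0 0).add (isHomogeneous_C_mul_X x1 1)).add
        (isHomogeneous_C_mul_X x2 2)).add (isHomogeneous_C_mul_X x3 3)
    have h2 : (2 : MvPolynomial (Fin 4) F) = C 2 := (map_ofNat C 2).symm
    have h3 : (3 : MvPolynomial (Fin 4) F) = C 3 := (map_ofNat C 3).symm
    intro i
    fin_cases i <;>
    · simp only [act, aeval_X, h2, h3, ← C_mul, ← C_pow, ← C_add]
      exact key _ _ _ _

theorem trBG_hom (p : ℕ) [Fact p.Prime] (F : Type) [Field F] [CharP F p]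
    (f : MvPolynomial (Fin 4) F) (n : ℕ)
    (hf : f.IsHomogeneous n) : (trBG p F f).IsHomogeneous n := by
  unfold trBG
  exact (IsHomogeneous.sum _ _ _ fun s _ => act_hom p F _ f n hf).add (act_hom p F _ f n hf)

theorem D_hom (F : Type) [Field F] : (Dpoly F).IsHomogeneous 4 := by
  have hX : ∀ i : Fin 4, (X i : MvPolynomial (Fin 4) F).IsHomogeneous 1 := isHomogeneous_X F
  have hc : ∀ c : F, (C c : MvPolynomial (Fin 4) F).IsHomogeneous 0 := isHomogeneous_C _
  have e : Dpoly F = C 3 * X 2 ^ 2 * X 1 ^ 2 - C 4 * X 3 * X 1 ^ 3 - C 4 * X 2 ^ 3 * X 0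
    + C 6 * X 3 * X 2 * X 1 * X 0 - X 3 ^ 2 * X 0 ^ 2 := by simp [Dpoly, map_ofNat]
  rw [e]
  refine ((((?_ : IsHomogeneous _ 4).sub (?_ : IsHomogeneous _ 4)).sub
    (?_ : IsHomogeneous _ 4)).add (?_ : IsHomogeneous _ 4)).sub (?_ : IsHomogeneous _ 4)
  · exact ((hc 3).mul ((hX 2).pow 2)).mul ((hX 1).pow 2)
  · exact ((hc 4).mul (hX 3)).mul ((hX 1).pow 3)
  · exact ((hc 4).mul ((hX 2).pow 3)).mul (hX 0)
  · exact ((((hc 6).mul (hX 3)).mul (hX 2)).mul (hX 1)).mul (hX 0)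
  · exact ((hX 3).pow 2).mul ((hX 0).pow 2)

theorem e_hom (F : Type) [Field F] : (epoly F).IsHomogeneous 3 := by
  have hX : ∀ i : Fin 4, (X i : MvPolynomial (Fin 4) F).IsHomogeneous 1 := isHomogeneous_X F
  have hc : ∀ c : F, (C c : MvPolynomial (Fin 4) F).IsHomogeneous 0 := isHomogeneous_C _
  have e : epoly F = C 2 * X 1 ^ 3 + X 0 * (X 3 * X 0 - C 3 * X 2 * X 1) := by
    simp [epoly, map_ofNat]
  rw [e]
  refine (?_ : IsHomogeneous _ 3).add ((hX 0).mul ((?_ : IsHomogeneous _ 2).sub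
    (?_ : IsHomogeneous _ 2)))
  · exact (hc 2).mul ((hX 1).pow 3)
  · exact (hX 3).mul (hX 0)
  · exact ((hc 3).mul (hX 2)).mul (hX 1)

theorem N_hom (p : ℕ) [Fact p.Prime] (F : Type) [Field F] [CharP F p] :
    (Npoly p F).IsHomogeneous p := by
  have := IsHomogeneous.prod (Finset.univ : Finset (ZMod p))
    (fun s => act p F !![1, s; 0, 1] (X 3)) (fun _ => 1)
    (fun s _ => act_hom p F _ _ _ (isHomogeneous_X F 3))
  simpa [ZMod.card, Npoly] using this

theorem hseq_hom (p : ℕ) [Fact p.Prime] (hp : 3 < p) (F : Type) [Field F] [CharP F p] (n : ℕ) :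
    (hseq p F n).IsHomogeneous (p + 3 + n * (p - 1)) := by
  obtain ⟨m, hm⟩ : ∃ m, p = 2 * m + 1 :=
    (Fact.out : p.Prime).odd_of_ne_two (by omega)
  have hK : (Kpoly p F).IsHomogeneous (p - 1) := by
    refine IsHomogeneous.neg (IsHomogeneous.sum _ _ _ fun s _ => act_hom p F _ _ _ ?_)
    exact isHomogeneous_X_pow 1 (p - 1)
  have h0 : (hseq p F 0).IsHomogeneous (p + 3) := by
    simp only [hseq]
    exact trBG_hom p F _ _ ((N_hom p F).mul (e_hom F))
  have hD : ((3 * Dpoly F) ^ ((p - 1) / 2)).IsHomogeneous (4 * ((p - 1) / 2)) := by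
    have e : 3 * Dpoly F = C 3 * Dpoly F := by rw [map_ofNat C 3]
    rw [e]
    exact ((D_hom F).C_mul 3).pow _
  have h1 : (hseq p F 1).IsHomogeneous (p + 3 + (p - 1)) := by
    have h0' := h0
    simp only [hseq] at h0' ⊢
    refine IsHomogeneous.sub ?_ ?_
    · have := hK.mul h0'
      rwa [add_comm] at this
    · have h2 : (trP p F (X 3 ^ (p - 2))).IsHomogeneous (p - 2) :=
        IsHomogeneous.sum _ _ _ fun s _ => act_hom p F _ _ _ (isHomogeneous_X_pow 3 (p - 2))
      have := (D_hom F).mul (trBG_hom p F _ _ ((N_hom p F).mul h2))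
      rwa [show 4 + (p + (p - 2)) = p + 3 + (p - 1) by omega] at this
  induction n using Nat.twoStepInduction with
  | zero => simpa using h0
  | one => simpa using h1
  | more n ih0 ih1 =>
    simp only [hseq]
    refine IsHomogeneous.sub ?_ ?_
    · have := hK.mul ih1
      rwa [show p - 1 + (p + 3 + (n + 1) * (p - 1)) = p + 3 + (n + 2) * (p - 1) by ring] at this
    · have := hD.mul ih0
      rwa [show 4 * ((p - 1) / 2) + (p + 3 + n * (p - 1)) = p + 3 + (n + 2) * (p - 1) by
        rw [show 4 * ((p - 1) / 2) = 2 * (p - 1) by omega]; ring] at this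

theorem lead_aux (p : ℕ) [Fact p.Prime] (hp : 3 < p) (F : Type) [Field F] [CharP F p]
    (f : MvPolynomial (Fin 4) F) (M : ℕ) (hf : f.IsHomogeneous (p + M))
    (hpr : pr F f = X 1 ^ M * (2 * Nb p F)) :
    LeadTermIs f 2 (Finsupp.single 3 p + Finsupp.single 1 M) := by
  have hc : coeff (Finsupp.single 3 p + Finsupp.single 1 M) f = 2 := by
    rw [coeff_pr F f _ (by simp), hpr, add_comm, X_pow_eq_monomial,
      coeff_monomial_mul, one_mul]
    have h2 : (2 : MvPolynomial (Fin 4) F) = C 2 := (map_ofNat C 2).symm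
    rw [h2, coeff_C_mul]
    suffices coeff (Finsupp.single 3 p) (Nb p F) = 1 by rw [this, mul_one]
    have h3 : ∃ g h, Nb p F = X 3 ^ p + X 1 * g + X 2 * h := by
      have key : ∀ S : Finset (ZMod p), ∃ g h,
          ∏ s ∈ S, (3 * X 1 * io p F s ^ 2 + 3 * X 2 * io p F s + X 3) =
            X 3 ^ S.card + X 1 * g + X 2 * h := by
        intro S
        induction S using Finset.induction_on with
        | empty => exact ⟨0, 0, by simp⟩
        | insert a S ha ih =>
          obtain ⟨g, h, e⟩ := ih
          rw [Finset.prod_insert ha, Finset.card_insert_of_notMem ha, e]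
          refine ⟨3 * io p F a ^ 2 * (X 3 ^ S.card + X 1 * g + X 2 * h) + X 3 * g,
            3 * io p F a * (X 3 ^ S.card + X 1 * g + X 2 * h) + X 3 * h, ?_⟩
          ring
      obtain ⟨g, h, e⟩ := key Finset.univ
      rw [Finset.card_univ, ZMod.card] at e
      exact ⟨g, h, e⟩
    obtain ⟨g, h, e⟩ := h3
    rw [e, coeff_add, coeff_add, coeff_X_mul', coeff_X_mul', if_neg, if_neg, X_pow_eq_monomial,
      coeff_monomial, if_pos rfl]
    · ring
    · simp [Finsupp.single_apply]
    · simp [Finsupp.single_apply]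
  refine ⟨⟨by rw [hc]; exact two_ne p hp F, ?_⟩, hc⟩
  intro e he hne
  have hdeg : ∑ i, e i = p + M := by
    have := hf.degree_eq_sum_deg_support he
    rw [this]
    exact (Finset.sum_subset (Finset.subset_univ _) (by intro i _ hi; simpa using hi)).symm
  right
  simp only [Fin.sum_univ_four] at hdeg ⊢
  have t0 : (Finsupp.single 3 p + Finsupp.single 1 M : Fin 4 →₀ ℕ) 0 = 0 := by simp
  have t1 : (Finsupp.single 3 p + Finsupp.single 1 M : Fin 4 →₀ ℕ) 1 = M := by
    simp [Finsupp.single_apply]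
  have t2 : (Finsupp.single 3 p + Finsupp.single 1 M : Fin 4 →₀ ℕ) 2 = 0 := by
    simp [Finsupp.single_apply]
  have t3 : (Finsupp.single 3 p + Finsupp.single 1 M : Fin 4 →₀ ℕ) 3 = p := by
    simp [Finsupp.single_apply]
  refine ⟨by rw [t0, t1, t2, t3]; omega, ?_⟩
  by_cases h0 : e 0 = 0
  · have h1 : M ≤ e 1 := by
      rw [mem_support_iff, coeff_pr F f e h0, hpr, X_pow_eq_monomial, coeff_monomial_mul'] at he
      by_contra hlt
      apply he
      rw [if_neg]
      intro hle
      have := hle 1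
      simp at this
      omega
    by_cases h1' : e 1 = M
    · by_cases h2 : e 2 = 0
      · exfalso
        apply hne
        ext i
        fin_cases i
        · exact h0.trans t0.symm
        · exact h1'.trans t1.symm
        · exact h2.trans t2.symm
        · refine Eq.trans ?_ t3.symm
          show e 3 = p
          omega
      · refine ⟨2, by rw [t2]; omega, ?_⟩
        intro j hj
        fin_cases j
        · exact h0.trans t0.symm
        · exact h1'.trans t1.symm
        · exact absurd hj (by decide)
        · exact absurd hj (by decide)
    · refine ⟨1, by rw [t1]; omega, ?_⟩
      intro j hj
      fin_cases j
      · exact h0.trans t0.symm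
      · exact absurd hj (by decide)
      · exact absurd hj (by decide)
      · exact absurd hj (by decide)
  · refine ⟨0, by rw [t0]; omega, ?_⟩
    intro j hj
    exact absurd hj (by simp)

/-- each `h_i` (`i ≥ 1`) is `SL₂(F_p)`-invariant and its lead term in the
grevlex order with `a₀ < a₁ < a₂ < a₃` is `2 a₃^p a₁^{p+2+(i-1)(p-1)}`. -/
theorem inffamthm (p : ℕ) [Fact p.Prime] (hp : 3 < p)
    (F : Type) [Field F] [CharP F p] (i : ℕ) (hi : 1 ≤ i) :
    hseq p F i ∈ invariants p F ∧
    LeadTermIs (hseq p F i) 2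
      (Finsupp.single 3 p + Finsupp.single 1 (p + 2 + (i - 1) * (p - 1))) := by
  refine ⟨hseq_inv p hp F i, ?_⟩
  obtain ⟨n, rfl⟩ : ∃ n, i = n + 1 := ⟨i - 1, by omega⟩
  rw [Nat.add_sub_cancel]
  apply lead_aux p hp F
  · have := hseq_hom p hp F (n + 1)
    rwa [show p + 3 + (n + 1) * (p - 1) = p + (p + 2 + n * (p - 1)) by
      rw [add_mul]; omega] at this
  · rw [pr_hseq p hp F (n + 1)]
    have e : p + 2 + n * (p - 1) = (p - 1) * (n + 1) + 3 := by
      rw [mul_add, mul_comm n]; omega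
    rw [e, pow_add]
    ring

end
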